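/- There is no injective continuous group homomorphism from U(3) × Sp(2) into SO(6) × SO(4); that is, U(3) × Sp(2) is not isomorphic to a closed subgroup of SO(6) × SO(4). -/

import Mathlib

/-!
Statement 17: there is no injective continuous group homomorphism from `U(3) × Sp(2)`
into `SO(6) × SO(4)`.
-/

noncomputable section

/-- The special orthogonal group `SO n` as a set of real matrices. -/
def SOSet (n : ℕ) : Set (Matrix (Fin n) (Fin n) ℝ) :=
  {A | star A * A = 1 ∧ A * star A = 1 ∧ A.det = 1}

/-- The compact symplectic group `Sp 2` of quaternionic `2 × 2` unitary matrices. -/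
abbrev Sp2 : Type := unitary (Matrix (Fin 2) (Fin 2) (Quaternion ℝ))

end

/-- If `A` and `B` act on `v` like the quaternion units `i` and `j`, then the orbit vectors
`v`, `A v`, `B v`, `A (B v)` satisfy no nontrivial linear relation. -/
lemma eq_zero_of_quaternion_relation {V : Type*} [AddCommGroup V] [Module ℝ V]
    (A B : V →ₗ[ℝ] V) {v : V} (hv : v ≠ 0) (hAA : A (A v) = -v) (hAAB : A (A (B v)) = -B v)
    (hBB : B (B v) = -v) (hBA : B (A v) = -A (B v)) (hBAB : B (A (B v)) = A v)
    {x₀ x₁ x₂ x₃ : ℝ} (h : x₀ • v + x₁ • A v + x₂ • B v + x₃ • A (B v) = 0) :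
    x₀ = 0 ∧ x₁ = 0 ∧ x₂ = 0 ∧ x₃ = 0 := by
  have hA := congrArg A h
  have hB := congrArg B h
  have hAB := congrArg (fun w => A (B w)) h
  simp only [map_add, map_smul, map_neg, map_zero, hAA, hAAB, hBB, hBA, hBAB] at hA hB hAB
  have hsum : (x₀ ^ 2 + x₁ ^ 2 + x₂ ^ 2 + x₃ ^ 2) • v = 0 := by
    linear_combination (norm := module) x₀ • h - x₁ • hA - x₂ • hB - x₃ • hAB
  have hnorm := (smul_eq_zero.mp hsum).resolve_right hv
  refine ⟨?_, ?_, ?_, ?_⟩ <;> nlinarith [sq_nonneg x₀, sq_nonneg x₁, sq_nonneg x₂, sq_nonneg x₃]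

/-- A real representation of the extraspecial group `2₋^{1+4}` (generated by a quaternion pair
`a`, `b` and a commuting dihedral pair `c`, `d`, with central involution `z`) of dimension less
than `8` is trivial on the center. -/
lemma map_center_eq_one_of_finrank_lt {G V : Type*} [Monoid G] [AddCommGroup V] [Module ℝ V]
    [FiniteDimensional ℝ V] (ρ : Representation ℝ G V) (hdim : Module.finrank ℝ V < 8)
    {z a b c d : G} (hzz : z * z = 1) (hza : z * a = a * z) (hzb : z * b = b * z)
    (hzc : z * c = c * z) (hzd : z * d = d * z)
    (haa : a * a = z) (hbb : b * b = z) (hba : b * a = z * (a * b))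
    (hcc : c * c = 1) (hdd : d * d = 1) (hcd : c * d = z * (d * c))
    (hca : c * a = a * c) (hcb : c * b = b * c) :
    ρ z = 1 := by
  have act {g h : G} (hgh : g = h) (x : V) : ρ g x = ρ h x := by rw [hgh]
  have hzz := act hzz
  have hza := act hza
  have hzb := act hzb
  have hzc := act hzc
  have hzd := act hzd
  have haa := act haa
  have hbb := act hbb
  have hba := act hba
  have hcc := act hcc
  have hdd := act hdd
  have hcd := act hcd
  have hca := act hca
  have hcb := act hcb
  simp only [map_mul, map_one, Module.End.mul_apply, Module.End.one_apply] at *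
  by_contra hz
  obtain ⟨w, hw⟩ : ∃ w, ρ z w ≠ w := by
    by_contra! h
    exact hz (LinearMap.ext h)
  obtain ⟨u, hu, hzu⟩ : ∃ u, u ≠ 0 ∧ ρ z u = -u :=
    ⟨ρ z w - w, sub_ne_zero.mpr hw, by rw [map_sub, hzz, neg_sub]⟩
  obtain ⟨v, hv, hzv, hcv⟩ : ∃ v, v ≠ 0 ∧ ρ z v = -v ∧ ρ c v = v := by
    by_cases h : u + ρ c u = 0
    · have hcu : ρ c u = -u := (neg_eq_of_add_eq_zero_right h).symm
      refine ⟨ρ d u, fun h0 => hu ?_, ?_, ?_⟩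
      · rw [← hdd u, h0, map_zero]
      · rw [hzd, hzu, map_neg]
      · rw [hcd, hcu, map_neg, map_neg, hzd, hzu, map_neg, neg_neg]
    · refine ⟨u + ρ c u, h, ?_, ?_⟩
      · rw [map_add, hzc, hzu, map_neg, neg_add]
      · rw [map_add, hcc, add_comm]
  have hrel {x₀ x₁ x₂ x₃ : ℝ} :=
    eq_zero_of_quaternion_relation (ρ a) (ρ b) hv (x₀ := x₀) (x₁ := x₁) (x₂ := x₂) (x₃ := x₃)
      (by rw [haa, hzv]) (by rw [haa, hzb, hzv, map_neg]) (by rw [hbb, hzv])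
      (by rw [hba, hza, hzb, hzv, map_neg, map_neg])
      (by rw [hba, hbb, hzv, map_neg, map_neg, hza, hzv, map_neg, neg_neg])
  have hli : LinearIndependent ℝ ![v, ρ a v, ρ b v, ρ a (ρ b v),
      ρ d v, ρ d (ρ a v), ρ d (ρ b v), ρ d (ρ a (ρ b v))] := by
    rw [Fintype.linearIndependent_iff]
    intro x hx
    simp only [Fin.sum_univ_eight] at hx
    set p := x 0 • v + x 1 • ρ a v + x 2 • ρ b v + x 3 • ρ a (ρ b v) with hp
    set q := x 4 • v + x 5 • ρ a v + x 6 • ρ b v + x 7 • ρ a (ρ b v) with hq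
    have hpq : p + ρ d q = 0 := by
      rw [← hx, hp, hq]
      simp only [map_add, map_smul]
      simp [add_assoc]
    have hcp : ρ c p = p := by simp [hp, hca, hcb, hcv]
    have hcq : ρ c q = q := by simp [hq, hca, hcb, hcv]
    have hzq : ρ z q = -q := by
      simp only [hq, map_add, map_smul, hza, hzb, hzv, map_neg, smul_neg, neg_add]
    have hpq' : p - ρ d q = 0 := by
      have h := congrArg (ρ c) hpq
      rwa [map_add, hcp, hcd, hcq, hzd, hzq, map_neg, map_zero, ← sub_eq_add_neg] at h
    have hp0 : p = 0 := by
      linear_combination (norm := module) (1 / 2 : ℝ) • hpq + (1 / 2 : ℝ) • hpq'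
    have hq0 : q = 0 := by
      rw [hp0, zero_add] at hpq
      rw [← hdd q, hpq, map_zero]
    obtain ⟨h0, h1, h2, h3⟩ := hrel hp0
    obtain ⟨h4, h5, h6, h7⟩ := hrel hq0
    intro i
    fin_cases i <;> assumption
  have := hli.fintype_card_le_finrank
  rw [Fintype.card_fin] at this
  omega

open scoped Quaternion in
/-- The quaternion units `i` and `j`. -/
lemma Quaternion.exists_anticommuting_units : ∃ i j : Quaternion ℝ,
    star i = -i ∧ star j = -j ∧ i * i = -1 ∧ j * j = -1 ∧ j * i = -(i * j) := by
  obtain ⟨i, hi₀, hi₁, hi₂, hi₃⟩ : ∃ i : Quaternion ℝ,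
      i.re = 0 ∧ i.imI = 1 ∧ i.imJ = 0 ∧ i.imK = 0 := ⟨⟨0, 1, 0, 0⟩, rfl, rfl, rfl, rfl⟩
  obtain ⟨j, hj₀, hj₁, hj₂, hj₃⟩ : ∃ j : Quaternion ℝ,
      j.re = 0 ∧ j.imI = 0 ∧ j.imJ = 1 ∧ j.imK = 0 := ⟨⟨0, 0, 1, 0⟩, rfl, rfl, rfl, rfl⟩
  refine ⟨i, j, ?_, ?_, ?_, ?_, ?_⟩ <;> ext <;>
    simp [hi₀, hi₁, hi₂, hi₃, hj₀, hj₁, hj₂, hj₃]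

/-- The element `-1` of `Sp 2` acts trivially in every real representation of dimension less
than `8`. -/
lemma Sp2.map_neg_one_eq_one {n : ℕ} (hn : n < 8) (ρ : Sp2 →* Matrix (Fin n) (Fin n) ℝ) :
    ρ (-1) = 1 := by
  obtain ⟨i, j, hi, hj, hii, hjj, hji⟩ := Quaternion.exists_anticommuting_units
  have scalar (q : Quaternion ℝ) (hq : star q = -q) (hqq : q * q = -1) :
      ∃ g : Sp2, g.1 = !![q, 0; 0, q] :=
    ⟨⟨_, by
      rw [Unitary.mem_iff]
      constructor <;> ext k l : 1 <;> fin_cases k <;> fin_cases l <;>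
        simp [Matrix.mul_apply, Matrix.star_apply, hq, hqq]⟩, rfl⟩
  obtain ⟨a, ha⟩ := scalar i hi hii
  obtain ⟨b, hb⟩ := scalar j hj hjj
  obtain ⟨c, hc⟩ : ∃ g : Sp2, g.1 = !![1, 0; 0, -1] :=
    ⟨⟨_, by
      rw [Unitary.mem_iff]
      constructor <;> ext k l : 1 <;> fin_cases k <;> fin_cases l <;>
        simp [Matrix.mul_apply, Matrix.star_apply]⟩, rfl⟩
  obtain ⟨d, hd⟩ : ∃ g : Sp2, g.1 = !![0, 1; 1, 0] :=
    ⟨⟨_, by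
      rw [Unitary.mem_iff]
      constructor <;> ext k l : 1 <;> fin_cases k <;> fin_cases l <;>
        simp [Matrix.mul_apply, Matrix.star_apply]⟩, rfl⟩
  let σ : Representation ℝ Sp2 (Fin n → ℝ) :=
    (Matrix.toLinAlgEquiv' : Matrix (Fin n) (Fin n) ℝ ≃ₐ[ℝ] _).toMonoidHom.comp ρ
  have hσ : σ (-1) = 1 := by
    apply map_center_eq_one_of_finrank_lt σ (a := a) (b := b) (c := c) (d := d) (by simpa using hn)
    all_goals
      apply Subtype.ext
      simp [ha, hb, hc, hd, hii, hjj, hji, Unitary.coe_neg, Matrix.one_fin_two]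
  exact Matrix.toLinAlgEquiv'.injective (hσ.trans (map_one _).symm)

theorem statement17 :
    ¬ ∃ f : (Matrix.unitaryGroup (Fin 3) ℂ × Sp2) →*
        (Matrix (Fin 6) (Fin 6) ℝ × Matrix (Fin 4) (Fin 4) ℝ),
      Continuous f ∧ Function.Injective f ∧
      ∀ x, (f x).1 ∈ SOSet 6 ∧ (f x).2 ∈ SOSet 4 := by
  rintro ⟨f, -, hf, -⟩
  let g := f.comp (MonoidHom.inr (Matrix.unitaryGroup (Fin 3) ℂ) Sp2)
  have hg : g (-1) = g 1 := by
    rw [map_one]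
    exact Prod.ext (Sp2.map_neg_one_eq_one (by norm_num) ((MonoidHom.fst _ _).comp g))
      (Sp2.map_neg_one_eq_one (by norm_num) ((MonoidHom.snd _ _).comp g))
  have hone : (-1 : Sp2) = 1 := congrArg Prod.snd (hf hg)
  have hentry := congrArg (fun x : Sp2 => (x.1 0 0).re) hone
  norm_num [Unitary.coe_neg, Quaternion.re_one] at hentry
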